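/- Let p₁,…,p₆ and q₁,…,q₆ be two families of six points in ℝ², each with nonsingular Vandermonde matrix, with associated energy-sampling shape functions ψᵢ^{(p)} and ψᵢ^{(q)}. Let r₁,…,r_N ∈ ℝ² and define wᵢ^{(p)} := Σ_{α=1}^{N} ψᵢ^{(p)}(r_α) and wᵢ^{(q)} := Σ_{α=1}^{N} ψᵢ^{(q)}(r_α). Then the sampled total energy is independent of the admissible selection of primary sampling nodes: for every U in Q (the span of {1, x, y, xy, x², y²}), Σ_{i=1}^{6} wᵢ^{(p)} · U(pᵢ) = Σ_{i=1}^{6} wᵢ^{(q)} · U(qᵢ). -/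

import Mathlib

open Matrix Finset

noncomputable section

/-- The Vandermonde-type row `[1, x, y, x², y², x·y]` associated to a point `r = (x,y) ∈ ℝ²`. -/
def vrow (r : ℝ × ℝ) : Fin 6 → ℝ := ![1, r.1, r.2, r.1 ^ 2, r.2 ^ 2, r.1 * r.2]

/-- The 6×6 Vandermonde matrix of six points in ℝ². -/
def vand (p : Fin 6 → ℝ × ℝ) : Matrix (Fin 6) (Fin 6) ℝ := fun i => vrow (p i)

/-- The energy-sampling shape function `ψᵢ(x,y) = det Aᵢ(x,y) / det A`. -/
def psi (p : Fin 6 → ℝ × ℝ) (i : Fin 6) (r : ℝ × ℝ) : ℝ :=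
  ((vand p).updateRow i (vrow r)).det / (vand p).det

/-- `Q`: the space of real polynomial functions on ℝ² spanned by `{1, x, y, xy, x², y²}`. -/
def Qspan : Submodule ℝ ((ℝ × ℝ) → ℝ) :=
  Submodule.span ℝ (Set.range fun j : Fin 6 => fun r : ℝ × ℝ => vrow r j)

/-- A bilinear function on ℝ²: `φ(x,y) = a₀ + a₁ x + a₂ y + a₃ x y`. -/
def bilin (a : Fin 4 → ℝ) (x y : ℝ) : ℝ := a 0 + a 1 * x + a 2 * y + a 3 * (x * y)

/-- The shape functions reproduce every function in `Q` from its values at the nodes. -/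
theorem sum_psi_mul_of_mem_Qspan (p : Fin 6 → ℝ × ℝ) (hp : (vand p).det ≠ 0)
    {U : (ℝ × ℝ) → ℝ} (hU : U ∈ Qspan) (s : ℝ × ℝ) :
    ∑ i, psi p i s * U (p i) = U s := by
  induction hU using Submodule.span_induction with
  | mem f hf =>
    obtain ⟨j, rfl⟩ := hf
    have h := congrFun (mulVec_cramer (vand p)ᵀ (vrow s)) j
    simp only [mulVec, dotProduct, transpose_apply, cramer_transpose_apply, det_transpose,
      Pi.smul_apply, smul_eq_mul] at h
    simp only [psi, div_mul_eq_mul_div, ← Finset.sum_div]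
    rw [div_eq_iff hp, mul_comm (vrow s j), ← h]
    exact Finset.sum_congr rfl fun i _ => mul_comm _ _
  | zero => simp
  | add f g _ _ hf hg => simp [mul_add, Finset.sum_add_distrib, hf, hg]
  | smul c f _ hf => simp [mul_left_comm _ c, ← Finset.mul_sum, hf]

/-- The sampled energy of a function in `Q` is the sum of its values at the sampling points. -/
theorem sum_weight_mul_of_mem_Qspan (p : Fin 6 → ℝ × ℝ) (hp : (vand p).det ≠ 0)
    {N : ℕ} (r : Fin N → ℝ × ℝ) {U : (ℝ × ℝ) → ℝ} (hU : U ∈ Qspan) :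
    ∑ i, (∑ α, psi p i (r α)) * U (p i) = ∑ α, U (r α) := by
  simp only [Finset.sum_mul]
  rw [Finset.sum_comm]
  exact Finset.sum_congr rfl fun α _ => sum_psi_mul_of_mem_Qspan p hp hU (r α)

/-- The sampled total energy is independent of the admissible selection of
primary sampling nodes: for two families of six points `p, q` with nonsingular Vandermonde
matrices and weights `wᵢ^{(p)} = Σ_α ψᵢ^{(p)}(r_α)`, `wᵢ^{(q)} = Σ_α ψᵢ^{(q)}(r_α)`, one has
`Σ_i wᵢ^{(p)}·U(pᵢ) = Σ_i wᵢ^{(q)}·U(qᵢ)` for every `U` in `Q`. -/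
theorem sampling_independent_of_node_selection (p q : Fin 6 → ℝ × ℝ)
    (hAp : (vand p).det ≠ 0) (hAq : (vand q).det ≠ 0)
    (N : ℕ) (r : Fin N → ℝ × ℝ) (U : (ℝ × ℝ) → ℝ) (hU : U ∈ Qspan) :
    ∑ i : Fin 6, (∑ α : Fin N, psi p i (r α)) * U (p i)
      = ∑ i : Fin 6, (∑ α : Fin N, psi q i (r α)) * U (q i) := by
  rw [sum_weight_mul_of_mem_Qspan p hAp r hU, sum_weight_mul_of_mem_Qspan q hAq r hU]
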